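/- arXiv:math/0506593 — 2 statements merged into one kernel-verified Lean document; each statement's English description precedes it below -/
import Mathlib

section
/- Let A be a commutative noetherian ring, M a finitely generated A-module, and p ≥ 0 an integer. Then the set X_p(M) = { q ∈ Spec A : Tor^{A_q}_p(κ(q), M_q) ≠ 0 } is a closed subset of Spec A (in the Zariski topology). -/
/-!
Let `A` be a commutative noetherian ring, `M` a finitely generated `A`-module, and `p ≥ 0`.
Then `X_p(M) = { q ∈ Spec A : Tor^{A_q}_p(κ(q), M_q) ≠ 0 }` is closed in `Spec A`.
-/

open CategoryTheory

universe u

namespace CategoryTheory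

open Limits

variable {C D : Type*} [Category* C] [Category* D] [Abelian C] [Abelian D]

namespace ProjectiveResolution

variable {X : C} (P : ProjectiveResolution X)

/-- The augmentation of a projective resolution, as a morphism to the resolved object. -/
noncomputable def augmentation : P.complex.X 0 ⟶ X := P.π.f 0

instance : Epi P.augmentation := inferInstanceAs (Epi (P.π.f 0))

lemma complex_d_comp_augmentation : P.complex.d 1 0 ≫ P.augmentation = 0 :=
  P.complex_d_comp_π_f_zero

lemma exact_augmentation :
    (ShortComplex.mk (P.complex.d 1 0) P.augmentation P.complex_d_comp_augmentation).Exact :=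
  P.exact₀

lemma isZero_leftDerived_succ_obj_iff [HasProjectiveResolutions C]
    (F : C ⥤ D) [F.Additive] (n : ℕ) :
    IsZero ((F.leftDerived (n + 1)).obj X) ↔
      (ShortComplex.mk (F.map (P.complex.d (n + 2) (n + 1))) (F.map (P.complex.d (n + 1) n))
        (by rw [← F.map_comp, P.complex.d_comp_d, F.map_zero])).Exact := by
  rw [(P.isoLeftDerivedObj F (n + 1)).isZero_iff]
  refine (HomologicalComplex.exactAt_iff_isZero_homology _ _).symm.trans ?_
  exact HomologicalComplex.exactAt_iff' _ (n + 2) (n + 1) n (by simp) (by simp)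

end ProjectiveResolution

namespace ShortComplex

lemma exact_comp_iff_mono {S : ShortComplex C} (hS : S.Exact) [Epi S.g] {Y : C} (i : S.X₃ ⟶ Y) :
    (ShortComplex.mk S.f (S.g ≫ i) (by simp)).Exact ↔ Mono i := by
  rw [exact_iff_mono_cokernel_desc]
  have := hS.mono_cokernelDesc
  have : Epi (cokernel.desc S.f S.g S.zero) := epi_of_epi_fac (cokernel.π_desc _ _ _)
  have : IsIso (cokernel.desc S.f S.g S.zero) := isIso_of_mono_of_epi _
  have h : cokernel.desc S.f (S.g ≫ i) (by simp) = cokernel.desc S.f S.g S.zero ≫ i := by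
    rw [← cancel_epi (cokernel.π S.f)]
    simp
  dsimp only
  rw [h, mono_comp_iff_of_isIso]

namespace ShortExact

variable {S : ShortComplex C}

/-- Splicing a projective resolution of `S.X₁` with the projective object `S.X₂` gives a
projective resolution of `S.X₃`. -/
noncomputable def projectiveResolution (hS : S.ShortExact) [Projective S.X₂]
    (P : ProjectiveResolution S.X₁) : ProjectiveResolution S.X₃ where
  complex := P.complex.augment (P.augmentation ≫ S.f)
    (by rw [← Category.assoc, P.complex_d_comp_augmentation, zero_comp])
  projective n := by
    cases n
    · assumption
    · exact P.projective _
  π := (ChainComplex.toSingle₀Equiv _ _).symm ⟨S.g, by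
    exact (by simp : (P.augmentation ≫ S.f) ≫ S.g = 0)⟩
  quasiIso := ⟨fun n => by
    have := hS.mono_f
    have := hS.epi_g
    rcases n with _ | _ | n
    · rw [ChainComplex.quasiIsoAt₀_iff, ShortComplex.quasiIso_iff_of_zeros' _ rfl rfl rfl]
      let φ : ShortComplex.mk (P.augmentation ≫ S.f) S.g (by simp) ⟶ S :=
        { τ₁ := P.augmentation, τ₂ := 𝟙 _, τ₃ := 𝟙 _ }
      have : Epi φ.τ₁ := inferInstanceAs (Epi P.augmentation)
      refine (ShortComplex.exact_and_epi_g_iff_of_iso ?_).2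
        ⟨(ShortComplex.exact_iff_of_epi_of_isIso_of_mono φ).2 hS.exact, hS.epi_g⟩
      refine ShortComplex.isoMk (Iso.refl _) (Iso.refl _) (Iso.refl _) ?_ ?_
      · exact (Category.id_comp _).trans (Category.comp_id _).symm
      · exact (Category.id_comp _).trans ((Category.comp_id _).trans
          (ChainComplex.toSingle₀Equiv_symm_apply_f_zero (C := P.complex.augment _ _) S.g _)).symm
    · rw [quasiIsoAt_iff_exactAt' _ _ (ChainComplex.exactAt_succ_single_obj _ _),
        HomologicalComplex.exactAt_iff' _ 2 1 0 (by simp) (by simp)]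
      exact (exact_comp_iff_mono P.exact_augmentation S.f).2 hS.mono_f
    · rw [quasiIsoAt_iff_exactAt' _ _ (ChainComplex.exactAt_succ_single_obj _ _),
        HomologicalComplex.exactAt_iff' _ (n + 3) (n + 2) (n + 1) (by simp) (by simp)]
      exact P.exact_succ n⟩

variable [Projective S.X₂] [HasProjectiveResolutions C] (F : C ⥤ D) [F.Additive]

lemma isZero_leftDerived_add_two_obj_iff (hS : S.ShortExact) (n : ℕ) :
    IsZero ((F.leftDerived (n + 2)).obj S.X₃) ↔ IsZero ((F.leftDerived (n + 1)).obj S.X₁) := by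
  let P := CategoryTheory.projectiveResolution S.X₁
  rw [P.isZero_leftDerived_succ_obj_iff,
    (hS.projectiveResolution P).isZero_leftDerived_succ_obj_iff]
  rfl

lemma isZero_leftDerived_one_obj_iff (hS : S.ShortExact) [PreservesFiniteColimits F] :
    IsZero ((F.leftDerived 1).obj S.X₃) ↔ Mono (F.map S.f) := by
  let P := CategoryTheory.projectiveResolution S.X₁
  let T : ShortComplex C := .mk (P.complex.d 1 0) P.augmentation P.complex_d_comp_augmentation
  have hT : (T.map F).Exact ∧ Epi (T.map F).g :=
    ⟨P.exact_augmentation.map_of_epi_of_preservesCokernel F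
      (inferInstanceAs (Epi P.augmentation)) inferInstance,
      inferInstanceAs (Epi (F.map P.augmentation))⟩
  have := hT.2
  have h : F.map ((hS.projectiveResolution P).complex.d 1 0) = (T.map F).g ≫ F.map S.f :=
    F.map_comp _ _
  refine ((hS.projectiveResolution P).isZero_leftDerived_succ_obj_iff F 0).trans
    (Iff.trans (Iff.of_eq ?_) (exact_comp_iff_mono hT.1 (F.map S.f)))
  simp only [h]
  rfl

end ShortExact

end ShortComplex

end CategoryTheory

namespace IsLocalRing

open Limits

variable {R : Type u} [CommRing R]

lemma nontrivial_tor_zero_residueField_iff [IsLocalRing R]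
    (M : Type u) [AddCommGroup M] [Module R M] [Module.Finite R M] :
    Nontrivial (((Tor (ModuleCat.{u} R) 0).obj (.of R (ResidueField R))).obj (.of R M)) ↔
      Nontrivial M := by
  let F := (MonoidalCategory.tensoringLeft (ModuleCat.{u} R)).obj (.of R (ResidueField R))
  have : PreservesFiniteColimits F :=
    inferInstanceAs (PreservesFiniteColimits (MonoidalCategory.tensorLeft _))
  rw [← not_iff_not, not_nontrivial_iff_subsingleton, not_nontrivial_iff_subsingleton,
    ← IsLocalRing.subsingleton_tensorProduct (R := R) (M := M)]
  exact (F.leftDerivedZeroIsoSelf.app (.of R M)).toLinearEquiv.toEquiv.subsingleton_congr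

variable {N L M : Type u} [AddCommGroup N] [Module R N] [AddCommGroup L] [Module R L]
  [AddCommGroup M] [Module R M] {f : N →ₗ[R] L} {g : L →ₗ[R] M}

lemma shortExact_moduleCat (hf : Function.Injective f) (hg : Function.Surjective g)
    (h : Function.Exact f g) :
    (ShortComplex.mk (ModuleCat.ofHom f) (ModuleCat.ofHom g) (by
      ext x; exact h.apply_apply_eq_zero x)).ShortExact where
  exact := (ShortComplex.ShortExact.moduleCat_exact_iff_function_exact _).2 h
  mono_f := (ModuleCat.mono_iff_injective _).2 hf
  epi_g := (ModuleCat.epi_iff_surjective _).2 hg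

lemma subsingleton_tor_one_residueField_iff_free [IsLocalRing R] [Module.Finite R N]
    [Module.Finite R L] [Module.Free R L] (hf : Function.Injective f) (hg : Function.Surjective g)
    (h : Function.Exact f g) :
    Subsingleton (((Tor (ModuleCat.{u} R) 1).obj (.of R (ResidueField R))).obj (.of R M)) ↔
      Module.Free R M := by
  let F := (MonoidalCategory.tensoringLeft (ModuleCat.{u} R)).obj (.of R (ResidueField R))
  have : PreservesFiniteColimits F :=
    inferInstanceAs (PreservesFiniteColimits (MonoidalCategory.tensorLeft _))
  have hL : Projective (ModuleCat.of R L) := inferInstance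
  rw [← ModuleCat.isZero_iff_subsingleton]
  constructor
  · intro H
    refine Module.free_of_lTensor_residueField_injective f g hg h ?_
    exact (ModuleCat.mono_iff_injective _).1
      (((shortExact_moduleCat hf hg h).isZero_leftDerived_one_obj_iff F).1 H)
  · intro
    exact isZero_Tor_succ_of_projective (ModuleCat.{u} R) (.of R (ResidueField R)) (.of R M) 0

lemma subsingleton_tor_add_two_iff [Module.Projective R L] (hf : Function.Injective f)
    (hg : Function.Surjective g) (h : Function.Exact f g) (K : ModuleCat.{u} R) (n : ℕ) :
    Subsingleton (((Tor (ModuleCat.{u} R) (n + 2)).obj K).obj (.of R M)) ↔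
      Subsingleton (((Tor (ModuleCat.{u} R) (n + 1)).obj K).obj (.of R N)) := by
  have hL : Projective (ModuleCat.of R L) := inferInstance
  rw [← ModuleCat.isZero_iff_subsingleton, ← ModuleCat.isZero_iff_subsingleton]
  exact (shortExact_moduleCat hf hg h).isZero_leftDerived_add_two_obj_iff _ n

end IsLocalRing

theorem isClosed_tor_nonvanishing_locus
    (A : Type u) [CommRing A] [IsNoetherianRing A]
    (M : Type u) [AddCommGroup M] [Module A M] [Module.Finite A M] (p : ℕ) :
    IsClosed {q : PrimeSpectrum A |
      Nontrivial (((Tor (ModuleCat.{u} (Localization.AtPrime q.asIdeal)) p).obj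
          (ModuleCat.of (Localization.AtPrime q.asIdeal)
            (IsLocalRing.ResidueField (Localization.AtPrime q.asIdeal)))).obj
        (ModuleCat.of (Localization.AtPrime q.asIdeal)
          (LocalizedModule q.asIdeal.primeCompl M)))} := by
  induction p generalizing M with
  | zero =>
    simp_rw [IsLocalRing.nontrivial_tor_zero_residueField_iff]
    exact Module.isClosed_support
  | succ p ih =>
    obtain ⟨n, g, hg⟩ := Module.Finite.exists_fin' A M
    have hf (q : PrimeSpectrum A) := LocalizedModule.map_injective q.asIdeal.primeCompl
      g.ker.subtype g.ker.subtype_injective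
    have hg (q : PrimeSpectrum A) := LocalizedModule.map_surjective q.asIdeal.primeCompl g hg
    have h (q : PrimeSpectrum A) : Function.Exact
        (LocalizedModule.map q.asIdeal.primeCompl g.ker.subtype)
        (LocalizedModule.map q.asIdeal.primeCompl g) :=
      LocalizedModule.map_exact q.asIdeal.primeCompl _ _ g.exact_subtype_ker_map
    have hL (q : PrimeSpectrum A) : Module.Free (Localization.AtPrime q.asIdeal)
        (LocalizedModule q.asIdeal.primeCompl (Fin n → A)) :=
      Module.free_of_isLocalizedModule q.asIdeal.primeCompl
        (LocalizedModule.mkLinearMap q.asIdeal.primeCompl _)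
    rcases p with _ | p
    · have := Module.finitePresentation_of_finite A M
      rw [← isOpen_compl_iff]
      convert! Module.isOpen_freeLocus (R := A) (M := M) using 1
      ext q
      rw [Set.mem_compl_iff, Set.mem_ofPred_eq, not_nontrivial_iff_subsingleton]
      exact IsLocalRing.subsingleton_tor_one_residueField_iff_free
        (N := LocalizedModule q.asIdeal.primeCompl g.ker)
        (L := LocalizedModule q.asIdeal.primeCompl (Fin n → A))
        (M := LocalizedModule q.asIdeal.primeCompl M) (hf q) (hg q) (h q)
    · convert! ih g.ker using 1
      ext q
      rw [Set.mem_ofPred_eq, Set.mem_ofPred_eq, ← not_iff_not, not_nontrivial_iff_subsingleton,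
        not_nontrivial_iff_subsingleton]
      exact IsLocalRing.subsingleton_tor_add_two_iff
        (N := LocalizedModule q.asIdeal.primeCompl g.ker)
        (L := LocalizedModule q.asIdeal.primeCompl (Fin n → A))
        (M := LocalizedModule q.asIdeal.primeCompl M) (hf q) (hg q) (h q) _ p
end

section
/- Let π: B → A be a surjective homomorphism of commutative rings admitting a ring-homomorphism section ι: A → B (i.e. π ∘ ι = id_A). Suppose there exists a B-module N which is faithful (its annihilator in B is zero) and which, regarded as an A-module by restriction of scalars along ι, is free of rank one. Then π and ι are ring isomorphisms. -/
/-!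
Let `π : B → A` be a surjective ring homomorphism admitting a ring-homomorphism section
`ι : A → B` (`π ∘ ι = id`).  Suppose there is a `B`-module `N` that is faithful (zero
annihilator) and that, regarded as an `A`-module by restriction of scalars along `ι`, is free
of rank one (i.e. has a basis consisting of a single element `e`, so that `a ↦ ι a • e` is a
bijection `A → N`).  Then `π` and `ι` are ring isomorphisms.
-/

universe u

theorem bijective_of_faithful_module_free_rank_one_over_section
    (A B : Type u) [CommRing A] [CommRing B]
    (π : B →+* A) (ι : A →+* B)
    (hπ : Function.Surjective π) (hsec : π.comp ι = RingHom.id A)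
    (N : Type u) [AddCommGroup N] [Module B N]
    -- `N` is a faithful `B`-module (its annihilator in `B` is zero) :
    (hfaith : ∀ b : B, (∀ n : N, b • n = 0) → b = 0)
    -- `N`, as an `A`-module via `ι`, is free of rank one :
    (hfree : ∃ e : N, Function.Bijective fun a : A => ι a • e) :
    Function.Bijective π ∧ Function.Bijective ι := by
  obtain ⟨e, -, he⟩ := hfree
  have hleft : Function.LeftInverse π ι := fun a => RingHom.congr_fun hsec a
  have hι : Function.Surjective ι := by
    intro b
    obtain ⟨a, ha : ι a • e = b • e⟩ := he (b • e)
    refine ⟨a, sub_eq_zero.mp (hfaith _ fun n => ?_)⟩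
    obtain ⟨c, rfl⟩ := he n
    rw [smul_comm, sub_smul, ha, sub_self, smul_zero]
  exact ⟨⟨(hleft.rightInverse_of_surjective hι).injective, hπ⟩, hleft.injective, hι⟩
end
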